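/- Let G be a connected graph and H a connected graph with at least 2 vertices. Then Z_c(G ∘ H) = |V(G)|·(Z(H) + 1). -/

import Mathlib

open SimpleGraph

variable {V : Type*} {α β : Type*}

/-- Vertices forced black starting from `B`. -/
inductive ZFClosure (G : SimpleGraph V) (B : Set V) : V → Prop
  | init {v : V} : v ∈ B → ZFClosure G B v
  | force {u v : V} : ZFClosure G B u → G.Adj u v →
      (∀ w, G.Adj u w → w ≠ v → ZFClosure G B w) → ZFClosure G B v

/-- `B` is a zero forcing set of `G`. -/
def IsZFS (G : SimpleGraph V) (B : Set V) : Prop := ∀ v : V, ZFClosure G B v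

/-- `B` is a connected zero forcing set of `G`. -/
def IsCZFS (G : SimpleGraph V) (B : Set V) : Prop :=
  IsZFS G B ∧ ∀ C : G.ConnectedComponent, (G.induce (B ∩ C.supp)).Connected

/-- The zero forcing number `Z(G)`. -/
noncomputable def zfNum (G : SimpleGraph V) : ℕ :=
  sInf {k | ∃ B : Set V, B.ncard = k ∧ IsZFS G B}

/-- The connected zero forcing number `Z_c(G)`. -/
noncomputable def czfNum (G : SimpleGraph V) : ℕ :=
  sInf {k | ∃ B : Set V, B.ncard = k ∧ IsCZFS G B}

/-- One step of the color change rule. -/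
def zfStep (G : SimpleGraph V) (S : Set V) : Set V :=
  S ∪ {w | ∃ b ∈ S, G.Adj b w ∧ ∀ x, G.Adj b x → x ∉ S → x = w}

/-- propagation time of `B` in `G`. -/
noncomputable def propTime (G : SimpleGraph V) (B : Set V) : ℕ :=
  sInf {t | (zfStep G)^[t] B = Set.univ}

/-- minimum connected propagation time. -/
noncomputable def minCPT (G : SimpleGraph V) : ℕ :=
  sInf {t | ∃ B : Set V, IsCZFS G B ∧ B.ncard = czfNum G ∧ propTime G B = t}

/-- maximum connected propagation time. -/
noncomputable def maxCPT (G : SimpleGraph V) : ℕ :=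
  sSup {t | ∃ B : Set V, IsCZFS G B ∧ B.ncard = czfNum G ∧ propTime G B = t}

/-- Strong product of graphs. -/
def StrongProd (G : SimpleGraph α) (H : SimpleGraph β) : SimpleGraph (α × β) :=
  SimpleGraph.fromRel (fun a b =>
    (a.1 = b.1 ∧ H.Adj a.2 b.2) ∨ (a.2 = b.2 ∧ G.Adj a.1 b.1) ∨
      (G.Adj a.1 b.1 ∧ H.Adj a.2 b.2))

/-- Corona product of graphs. -/
def Corona (G : SimpleGraph α) (H : SimpleGraph β) : SimpleGraph (α ⊕ α × β) :=
  SimpleGraph.fromRel (fun a b =>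
    match a, b with
    | .inl u, .inl v => G.Adj u v
    | .inl u, .inr (v, _) => u = v
    | .inr (u, w), .inr (v, w') => u = v ∧ H.Adj w w'
    | _, _ => False)

/-- Generalized corona. -/
def GenCorona {n : ℕ} {W : Fin n → Type*} (G : SimpleGraph (Fin n))
    (H : ∀ i, SimpleGraph (W i)) : SimpleGraph (Fin n ⊕ Σ i, W i) :=
  SimpleGraph.fromRel (fun a b =>
    match a, b with
    | .inl i, .inl j => G.Adj i j
    | .inl i, .inr ⟨j, _⟩ => i = j
    | .inr ⟨i, w⟩, .inr ⟨j, w'⟩ => ∃ h : i = j, (H j).Adj (h ▸ w) w'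
    | _, _ => False)

/-- Wheel graph with hub `none` and rim a cycle on `m` vertices. -/
def WheelGraph (m : ℕ) : SimpleGraph (Option (Fin m)) :=
  SimpleGraph.fromRel (fun a b =>
    a = none ∨ ∃ i j, a = some i ∧ b = some j ∧ (cycleGraph m).Adj i j)


namespace Corona

variable (G : SimpleGraph α) (H : SimpleGraph β)

@[simp] theorem adj_inl_inl (i j : α) : (Corona G H).Adj (.inl i) (.inl j) ↔ G.Adj i j := by
  simp only [Corona, SimpleGraph.fromRel_adj, ne_eq, Sum.inl.injEq, G.adj_comm j i, or_self,
    and_iff_right_iff_imp]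
  exact fun h => h.ne

@[simp] theorem adj_inl_inr (i j : α) (w : β) :
    (Corona G H).Adj (.inl i) (.inr (j, w)) ↔ i = j := by
  simp [Corona]

@[simp] theorem adj_inr_inl (i j : α) (w : β) :
    (Corona G H).Adj (.inr (j, w)) (.inl i) ↔ i = j := by
  simp [Corona]

@[simp] theorem adj_inr_inr (i j : α) (v w : β) :
    (Corona G H).Adj (.inr (i, v)) (.inr (j, w)) ↔ i = j ∧ H.Adj v w := by
  simp only [Corona, SimpleGraph.fromRel_adj, ne_eq, Sum.inr.injEq, Prod.mk.injEq, not_and]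
  constructor
  · rintro ⟨-, h | ⟨h, h'⟩⟩
    exacts [h, ⟨h.symm, h'.symm⟩]
  · rintro ⟨rfl, h⟩
    exact ⟨fun _ => h.ne, .inl ⟨rfl, h⟩⟩

variable {G H}

/-- If every hub lies in `B` and the hubs induce a connected graph, then so does `B`. -/
theorem induce_connected (hG : G.Connected) {B : Set (α ⊕ α × β)} (hB : ∀ i, .inl i ∈ B) :
    ((Corona G H).induce B).Connected := by
  have hub (i j : α) : ((Corona G H).induce B).Reachable ⟨.inl i, hB i⟩ ⟨.inl j, hB j⟩ :=
    (hG.preconnected i j).map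
      (⟨fun i => ⟨.inl i, hB i⟩, fun {a b} h => by simpa using h⟩ :
        G →g (Corona G H).induce B)
  obtain ⟨i⟩ := hG.nonempty
  refine SimpleGraph.connected_iff_exists_forall_reachable _ |>.2 ⟨⟨.inl i, hB i⟩, ?_⟩
  rintro ⟨j | ⟨j, w⟩, hx⟩
  · exact hub i j
  · refine (hub i j).trans (SimpleGraph.Adj.reachable ?_)
    simp

theorem connected (hG : G.Connected) : (Corona G H).Connected :=
  (SimpleGraph.induceUnivIso (Corona G H)).connected_iff.1
    (induce_connected hG fun _ => Set.mem_univ _)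

/-- Forcing in a corona restricts to forcing in each copy of `H`. -/
theorem zfClosure_restrict (hH : ∀ w, ∃ v, H.Adj v w) {B : Set (α ⊕ α × β)} {i : α} {w : β}
    (h : ZFClosure (Corona G H) B (.inr (i, w))) :
    ZFClosure H {w | .inr (i, w) ∈ B} w := by
  generalize hx : (Sum.inr (i, w) : α ⊕ α × β) = x at h
  induction h generalizing w with
  | init h => exact .init (by subst hx; exact h)
  | @force u v _ huv _ ihu ih =>
    subst hx
    rcases u with j | ⟨j, u⟩
    · obtain rfl : j = i := by simpa using huv
      have others (v : β) (hv : v ≠ w) : ZFClosure H {w | .inr (j, w) ∈ B} v :=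
        ih (.inr (j, v)) (by simp) (by simpa using hv) rfl
      obtain ⟨v, hv⟩ := hH w
      exact .force (others v hv.ne) hv fun v' _ => others v'
    · obtain ⟨rfl, huw⟩ : j = i ∧ H.Adj u w := by simpa using huv
      exact .force (ihu rfl) huw fun v hv hvw =>
        ih (.inr (j, v)) (by simpa using hv) (by simpa using hvw) rfl

/-- Forcing in a copy of `H` extends to the corona when the hub is black. -/
theorem zfClosure_extend {B : Set (α ⊕ α × β)} {i : α} (hi : .inl i ∈ B) {w : β}
    (h : ZFClosure H {w | .inr (i, w) ∈ B} w) :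
    ZFClosure (Corona G H) B (.inr (i, w)) := by
  induction h with
  | init h => exact .init h
  | @force u v _ huv _ ihu ih =>
    refine .force ihu (by simpa using huv) ?_
    rintro (j | ⟨j, w⟩) hw hne
    · obtain rfl : j = i := by simpa using hw
      exact .init hi
    · obtain ⟨rfl, huw⟩ : i = j ∧ H.Adj u w := by simpa using hw
      exact ih w huw (by simpa using hne)

end Corona

open scoped Classical in
theorem Set.ncard_sum_prod [Fintype α] [Fintype β] (B : Set (α ⊕ α × β)) :
    B.ncard = ∑ i : α, ((if .inl i ∈ B then 1 else 0) + {w | .inr (i, w) ∈ B}.ncard) := by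
  simp only [Set.ncard_eq_toFinset_card', Set.toFinset_card, Fintype.card_subtype,
    Finset.card_filter, Fintype.sum_sum_type, Fintype.sum_prod_type, Finset.sum_add_distrib,
    Set.mem_ofPred_eq]

theorem zfNum_le {G : SimpleGraph V} {B : Set V} (h : IsZFS G B) : zfNum G ≤ B.ncard :=
  Nat.sInf_le ⟨B, rfl, h⟩

theorem exists_isZFS_ncard_eq_zfNum (G : SimpleGraph V) :
    ∃ B : Set V, B.ncard = zfNum G ∧ IsZFS G B :=
  Nat.sInf_mem (s := {k | ∃ B : Set V, B.ncard = k ∧ IsZFS G B})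
    ⟨_, Set.univ, rfl, fun _ => .init trivial⟩

theorem SimpleGraph.ConnectedComponent.supp_eq_univ {G : SimpleGraph V} (hG : G.Connected)
    (C : G.ConnectedComponent) : C.supp = Set.univ := by
  induction C using SimpleGraph.ConnectedComponent.ind with
  | h v => exact Set.eq_univ_of_forall fun w => ConnectedComponent.sound (hG.preconnected w v)

/-- A zero forcing set of a graph other than the full vertex set performs some first force. -/
theorem IsZFS.exists_first_force {G : SimpleGraph V} {B : Set V} (h : IsZFS G B) {x : V}
    (hx : x ∉ B) : ∃ u ∈ B, ∃ v ∉ B, G.Adj u v ∧ ∀ w, G.Adj u w → w ≠ v → w ∈ B := by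
  by_contra! hcon
  have key (v : V) (hv : ZFClosure G B v) : v ∈ B := by
    induction hv with
    | init h => exact h
    | @force u v _ huv _ ihu ih =>
      by_contra hv
      obtain ⟨w, hw, hwv, hwB⟩ := hcon u ihu v hv huv
      exact hwB (ih w hw hwv)
  exact hx (key x (h x))

/-- A black vertex all of whose neighbours are black makes one of those neighbours redundant. -/
theorem IsZFS.diff_singleton {G : SimpleGraph V} {B : Set V} (h : IsZFS G B) {u v : V}
    (hu : u ∈ B) (huv : G.Adj u v) (hB : ∀ w, G.Adj u w → w ∈ B) : IsZFS G (B \ {v}) := by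
  have hv : ZFClosure G (B \ {v}) v :=
    .force (.init ⟨hu, huv.ne⟩) huv fun w hw hwv => .init ⟨hB w hw, hwv⟩
  intro x
  induction h x with
  | @init x hx =>
    by_cases hxv : x = v
    · exact hxv ▸ hv
    · exact .init ⟨hx, hxv⟩
  | force _ huv _ ihu ih => exact .force ihu huv ih

namespace Corona

variable {G : SimpleGraph α} {H : SimpleGraph β}

theorem isZFS_restrict (hH : ∀ w, ∃ v, H.Adj v w) {B : Set (α ⊕ α × β)}
    (hB : IsZFS (Corona G H) B) (i : α) : IsZFS H {w | .inr (i, w) ∈ B} :=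
  fun w => zfClosure_restrict hH (hB (.inr (i, w)))

/-- A zero forcing set meets every copy of `H`. -/
theorem exists_inr_mem [Nonempty β] (hH : ∀ w, ∃ v, H.Adj v w) {B : Set (α ⊕ α × β)}
    (hB : IsZFS (Corona G H) B) (i : α) : ∃ w, .inr (i, w) ∈ B := by
  obtain ⟨w⟩ := ‹Nonempty β›
  induction isZFS_restrict hH hB i w with
  | init h => exact ⟨_, h⟩
  | force _ _ _ ihu _ => exact ihu

theorem inl_mem_of_connected [Nontrivial α] [Nonempty β] (hH : ∀ w, ∃ v, H.Adj v w)
    {B : Set (α ⊕ α × β)} (hB : IsZFS (Corona G H) B)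
    (hc : ((Corona G H).induce B).Connected) (i : α) : .inl i ∈ B := by
  by_contra hi
  obtain ⟨j, hj⟩ := exists_ne i
  obtain ⟨v, hv⟩ := exists_inr_mem hH hB i
  obtain ⟨w, hw⟩ := exists_inr_mem hH hB j
  have key (x : B) (hx : Relation.ReflTransGen ((Corona G H).induce B).Adj
      ⟨.inr (i, v), hv⟩ x) : ∃ u, x.1 = .inr (i, u) := by
    induction hx with
    | refl => exact ⟨v, rfl⟩
    | @tail x y _ hxy ih =>
      obtain ⟨u, hu⟩ := ih
      obtain ⟨y | ⟨k, y⟩, hy⟩ := y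
      · obtain rfl : y = i := by simpa [hu] using hxy
        exact absurd hy hi
      · obtain ⟨rfl, -⟩ : i = k ∧ H.Adj u y := by simpa [hu] using hxy
        exact ⟨y, rfl⟩
  obtain ⟨u, hu⟩ := key ⟨.inr (j, w), hw⟩
    ((SimpleGraph.reachable_iff_reflTransGen _ _).1 (hc.preconnected _ _))
  simp only [Sum.inr.injEq, Prod.mk.injEq] at hu
  exact hj hu.1

/-- With one hub, a zero forcing set avoiding it has more than `zfNum H` vertices. -/
theorem zfNum_lt_of_inl_notMem [Finite β] [Subsingleton α] (hH : ∀ w, ∃ v, H.Adj v w)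
    {B : Set (α ⊕ α × β)} (hB : IsZFS (Corona G H) B) {i : α} (hi : .inl i ∉ B) :
    zfNum H < {w | .inr (i, w) ∈ B}.ncard := by
  obtain ⟨u, hu, v, hv, -, h⟩ := hB.exists_first_force hi
  obtain j | ⟨j, u⟩ := u
  · exact absurd (Subsingleton.elim j i ▸ hu) hi
  obtain rfl := Subsingleton.elim i j
  obtain rfl : .inl i = v := by
    by_contra hne
    exact hi (h _ (by simp) hne)
  have hall (w : β) (hw : H.Adj u w) : w ∈ {w | .inr (i, w) ∈ B} :=
    h (.inr (i, w)) (by simpa using hw) (by simp)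
  obtain ⟨w, hw⟩ := hH u
  exact (zfNum_le ((isZFS_restrict hH hB i).diff_singleton hu hw.symm hall)).trans_lt
    (Set.ncard_sdiff_singleton_lt_of_mem (hall w hw.symm))

theorem card_mul_le_ncard [Fintype α] [Fintype β] [Nonempty β] (hG : G.Connected)
    (hH : ∀ w, ∃ v, H.Adj v w) {B : Set (α ⊕ α × β)} (hB : IsCZFS (Corona G H) B) :
    Fintype.card α * (zfNum H + 1) ≤ B.ncard := by
  obtain ⟨hB, hc⟩ := hB
  rw [Set.ncard_sum_prod, ← smul_eq_mul, ← Finset.card_univ]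
  refine Finset.card_nsmul_le_sum _ _ _ fun i _ => ?_
  have hle := zfNum_le (isZFS_restrict hH hB i)
  by_cases hi : .inl i ∈ B
  · rw [if_pos hi]
    omega
  · rcases subsingleton_or_nontrivial α with _ | _
    · rw [if_neg hi, zero_add]
      exact zfNum_lt_of_inl_notMem hH hB hi
    · have hcB := hc ((Corona G H).connectedComponentMk (.inl i))
      rw [ConnectedComponent.supp_eq_univ (connected hG), Set.inter_univ] at hcB
      exact absurd (inl_mem_of_connected hH hB hcB i) hi

theorem exists_isCZFS_ncard_eq [Fintype α] [Fintype β] (hG : G.Connected) :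
    ∃ B : Set (α ⊕ α × β),
      B.ncard = Fintype.card α * (zfNum H + 1) ∧ IsCZFS (Corona G H) B := by
  obtain ⟨S, hS, hSH⟩ := exists_isZFS_ncard_eq_zfNum H
  have hub (i : α) : .inl i ∈ {x : α ⊕ α × β | ∀ y, x = .inr y → y.2 ∈ S} := by simp
  have copy (i : α) : {w | .inr (i, w) ∈ {x : α ⊕ α × β | ∀ y, x = .inr y → y.2 ∈ S}} = S := by
    ext w
    simp
  refine ⟨{x | ∀ y, x = .inr y → y.2 ∈ S}, ?_, ?_, fun C => ?_⟩
  · rw [Set.ncard_sum_prod]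
    simp only [copy, hub, if_true, hS, Finset.sum_const, Finset.card_univ, smul_eq_mul, add_comm]
  · rintro (i | ⟨i, w⟩)
    · exact .init (hub i)
    · exact zfClosure_extend (hub i) (by rw [copy]; exact hSH w)
  · rw [ConnectedComponent.supp_eq_univ (connected hG), Set.inter_univ]
    exact induce_connected hG hub

end Corona

/-- `Z_c(G ∘ H) = |V(G)|·(Z(H) + 1)` for connected `G` and connected `H`
with at least two vertices. -/
theorem stmt14 {α β : Type*} [Fintype α] [Fintype β] [Nonempty α] [Nonempty β]
    (G : SimpleGraph α) (H : SimpleGraph β) (hG : G.Connected)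
    (hH : H.Connected) (hβ : 2 ≤ Fintype.card β) :
    czfNum (Corona G H) = Fintype.card α * (zfNum H + 1) := by
  obtain ⟨B, hcard, hB⟩ := Corona.exists_isCZFS_ncard_eq (H := H) hG
  have : Nontrivial β := Fintype.one_lt_card_iff_nontrivial.1 hβ
  have hadj (w : β) : ∃ v, H.Adj v w :=
    (hH.preconnected.exists_adj_of_nontrivial w).imp fun _ h => h.symm
  refine le_antisymm (Nat.sInf_le ⟨B, hcard, hB⟩)
    (le_csInf ⟨_, B, hcard, hB⟩ ?_)
  rintro _ ⟨B', rfl, hB'⟩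
  exact Corona.card_mul_le_ncard hG hadj hB'
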